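/- For every s ∈ ℕ and every q = (q_x, q_y) ∈ ℝ², (1/(2π))·∫_{ℝ²} exp(i(q_x p_y − q_y p_x))·L_s(|p|²)·e^{−|p|²/2} dp = (−1)^s·L_s(|q|²)·e^{−|q|²/2}. (This is the statement that the radial Laguerre–Gaussian functions are eigenfunctions, with eigenvalue (−1)^s, of the two-dimensional symplectic Fourier transform used to Fourier-transform the reduced structure factor.) -/

import Mathlib

open MeasureTheory Finset

/-- Generalized Laguerre polynomial
`L_n^{(α)}(x) = ∑_{k=0}^{n} ((−1)^k/k!)·((α+k+1)⋯(α+n)/(n−k)!)·x^k`,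
defined for any real `α`. -/
noncomputable def genLaguerre (n : ℕ) (α : ℝ) (x : ℝ) : ℝ :=
  ∑ k ∈ Finset.range (n + 1),
    ((-1 : ℝ) ^ k / k.factorial) *
      ((∏ j ∈ Finset.Icc (k + 1) n, (α + j)) / (n - k).factorial) * x ^ k

section GaussianMoments

/-- The symplectic phase and Gaussian weight, times a power of the squared radius. -/
noncomputable def phaseMoment (q : ℝ × ℝ) (k : ℕ) (a : ℝ) (p : ℝ × ℝ) : ℂ :=
  Complex.exp (Complex.I * ((q.1 * p.2 - q.2 * p.1 : ℝ) : ℂ)) *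
    (((p.1 ^ 2 + p.2 ^ 2) ^ k * Real.exp (-a * (p.1 ^ 2 + p.2 ^ 2)) : ℝ) : ℂ)

lemma norm_phaseMoment (q : ℝ × ℝ) (k : ℕ) (a : ℝ) (p : ℝ × ℝ) :
    ‖phaseMoment q k a p‖ = (p.1 ^ 2 + p.2 ^ 2) ^ k * Real.exp (-a * (p.1 ^ 2 + p.2 ^ 2)) := by
  rw [phaseMoment, norm_mul, mul_comm Complex.I, Complex.norm_exp_ofReal_mul_I, one_mul,
    Complex.norm_real, Real.norm_of_nonneg (by positivity)]

lemma continuous_phaseMoment (q : ℝ × ℝ) (k : ℕ) (a : ℝ) :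
    Continuous (phaseMoment q k a) := by
  unfold phaseMoment
  fun_prop

lemma integrable_radial_gaussian {a : ℝ} (ha : 0 < a) :
    Integrable (fun p : ℝ × ℝ => Real.exp (-a * (p.1 ^ 2 + p.2 ^ 2))) := by
  have h := (integrable_exp_neg_mul_sq ha).mul_prod (integrable_exp_neg_mul_sq ha)
  refine h.congr (Filter.Eventually.of_forall fun p => ?_)
  simp only [← Real.exp_add]
  ring_nf

lemma integrable_radial_pow_mul_gaussian (k : ℕ) {a : ℝ} (ha : 0 < a) :
    Integrable (fun p : ℝ × ℝ =>
      (p.1 ^ 2 + p.2 ^ 2) ^ k * Real.exp (-a * (p.1 ^ 2 + p.2 ^ 2))) := by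
  refine ((integrable_radial_gaussian (half_pos ha)).const_mul
    (k.factorial / (a / 2) ^ k)).mono' (by fun_prop) (Filter.Eventually.of_forall fun p => ?_)
  rw [Real.norm_of_nonneg (by positivity)]
  generalize hx : p.1 ^ 2 + p.2 ^ 2 = x
  have hx0 : 0 ≤ x := hx ▸ by positivity
  have h := Real.pow_div_factorial_le_exp (a / 2 * x) (by positivity) k
  rw [mul_pow, div_le_iff₀ (by positivity)] at h
  have hsplit : Real.exp (-(a / 2) * x) = Real.exp (a / 2 * x) * Real.exp (-a * x) := by
    rw [← Real.exp_add]; ring_nf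
  rw [hsplit, ← mul_assoc]
  gcongr
  rw [div_mul_eq_mul_div, le_div_iff₀ (by positivity)]
  linarith

lemma integrable_phaseMoment (q : ℝ × ℝ) (k : ℕ) {a : ℝ} (ha : 0 < a) :
    Integrable (phaseMoment q k a) :=
  (integrable_radial_pow_mul_gaussian k ha).mono'
    (continuous_phaseMoment q k a).aestronglyMeasurable
    (Filter.Eventually.of_forall fun p => (norm_phaseMoment q k a p).le)

lemma hasDerivAt_integral_phaseMoment (q : ℝ × ℝ) (k : ℕ) {a : ℝ} (ha : 0 < a) :
    HasDerivAt (fun a => ∫ p, phaseMoment q k a p) (-∫ p, phaseMoment q (k + 1) a p) a := by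
  rw [← integral_neg]
  refine (hasDerivAt_integral_of_dominated_loc_of_deriv_le
    (F' := fun a p => -phaseMoment q (k + 1) a p)
    (bound := fun p => (p.1 ^ 2 + p.2 ^ 2) ^ (k + 1) *
      Real.exp (-(a / 2) * (p.1 ^ 2 + p.2 ^ 2)))
    (Metric.ball_mem_nhds a (half_pos ha))
    (Filter.Eventually.of_forall fun b => (continuous_phaseMoment q k b).aestronglyMeasurable)
    (integrable_phaseMoment q k ha)
    (continuous_phaseMoment q (k + 1) a).neg.aestronglyMeasurable
    (Filter.Eventually.of_forall fun p b hb => ?_)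
    (integrable_radial_pow_mul_gaussian (k + 1) (half_pos ha))
    (Filter.Eventually.of_forall fun p b _ => ?_)).2
  · rw [norm_neg, norm_phaseMoment]
    rw [Metric.mem_ball, Real.dist_eq, abs_lt] at hb
    gcongr
    linarith [hb.1]
  · have h := ((((hasDerivAt_id b).neg.mul_const (p.1 ^ 2 + p.2 ^ 2)).exp.const_mul
      ((p.1 ^ 2 + p.2 ^ 2) ^ k)).ofReal_comp).const_mul
        (Complex.exp (Complex.I * ((q.1 * p.2 - q.2 * p.1 : ℝ) : ℂ)))
    refine h.congr_deriv ?_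
    simp only [phaseMoment, Pi.neg_apply, id]
    push_cast
    ring

lemma integral_phaseMoment_zero (q : ℝ × ℝ) {a : ℝ} (ha : 0 < a) :
    ∫ p, phaseMoment q 0 a p =
      ((Real.pi * a⁻¹ * Real.exp (-((q.1 ^ 2 + q.2 ^ 2) / 4) * a⁻¹) : ℝ) : ℂ) := by
  have hre : 0 < (a : ℂ).re := by simpa using ha
  have hsplit : ∀ p : ℝ × ℝ, phaseMoment q 0 a p =
      (Complex.exp (Complex.I * ((-q.2 : ℝ) : ℂ) * p.1) * Complex.exp (-a * p.1 ^ 2)) *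
      (Complex.exp (Complex.I * (q.1 : ℂ) * p.2) * Complex.exp (-a * p.2 ^ 2)) := by
    intro p
    simp only [phaseMoment, pow_zero, one_mul, Complex.ofReal_exp, ← Complex.exp_add]
    push_cast
    ring_nf
  simp_rw [hsplit]
  rw [show (volume : Measure (ℝ × ℝ)) = volume.prod volume from rfl,
    integral_prod_mul (fun x : ℝ => Complex.exp (Complex.I * ((-q.2 : ℝ) : ℂ) * x) *
      Complex.exp (-a * x ^ 2)) (fun x : ℝ => Complex.exp (Complex.I * (q.1 : ℂ) * x) *
      Complex.exp (-a * x ^ 2)), fourierIntegral_gaussian hre, fourierIntegral_gaussian hre]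
  have hne : (Real.pi / a : ℂ) ≠ 0 := by
    have := ha.ne'
    have := Real.pi_ne_zero
    simp [*]
  rw [mul_mul_mul_comm, ← Complex.cpow_add _ _ hne, ← Complex.exp_add]
  norm_num
  rw [← div_eq_mul_inv]
  congr 2
  have : (a : ℂ) ≠ 0 := by exact_mod_cast ha.ne'
  field_simp
  ring

/-- Closed form of the radial moments of a Gaussian under the symplectic phase, as a function of
the inverse width `b` and a quarter `r` of the squared frequency. -/
noncomputable def momentPoly (r : ℝ) (k : ℕ) (b : ℝ) : ℝ :=
  k.factorial * ∑ j ∈ range (k + 1),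
    (-r) ^ j / j.factorial * (k.choose j) * b ^ (k + 1 + j)

lemma momentPoly_eq_sum_range (r : ℝ) {k n : ℕ} (h : k ≤ n) (b : ℝ) :
    momentPoly r k b = k.factorial * ∑ j ∈ range (n + 1),
      (-r) ^ j / j.factorial * (k.choose j) * b ^ (k + 1 + j) := by
  rw [momentPoly]
  congr 1
  refine sum_subset (range_mono (by omega)) fun j _ hj => ?_
  rw [Nat.choose_eq_zero_of_lt (by simpa using hj)]
  simp

lemma hasDerivAt_momentPoly_mul_exp (r : ℝ) (k : ℕ) {a : ℝ} (ha : 0 < a) :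
    HasDerivAt (fun a => momentPoly r k a⁻¹ * Real.exp (-r * a⁻¹))
      (-(momentPoly r (k + 1) a⁻¹ * Real.exp (-r * a⁻¹))) a := by
  have hinv : HasDerivAt (fun a : ℝ => a⁻¹) (-(a⁻¹) ^ 2) a := by
    simpa using hasDerivAt_inv ha.ne'
  have hexp := (hinv.const_mul (-r)).exp
  have hsum : HasDerivAt (fun a => momentPoly r k a⁻¹)
      (k.factorial * ∑ j ∈ range (k + 1), (-r) ^ j / j.factorial * (k.choose j) *
        (((k + 1 + j : ℕ) : ℝ) * a⁻¹ ^ (k + j) * -(a⁻¹) ^ 2)) a := by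
    unfold momentPoly
    refine HasDerivAt.const_mul _ (HasDerivAt.fun_sum fun j _ => ?_)
    refine ((hinv.pow (k + 1 + j)).const_mul _).congr_deriv ?_
    rw [show k + 1 + j - 1 = k + j by omega]
  refine (hsum.mul hexp).congr_deriv ?_
  generalize a⁻¹ = b
  rw [momentPoly, momentPoly, sum_range_succ' _ (k + 1), Nat.factorial_succ]
  have hstep : ∀ j ∈ range (k + 1),
      ((k + 1 : ℕ) : ℝ) * ((-r) ^ (j + 1) / (j + 1).factorial * ((k + 1).choose (j + 1)) *
        b ^ (k + 1 + 1 + (j + 1))) =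
      (-r) ^ (j + 1) / (j + 1).factorial * (k.choose (j + 1)) *
        (((k + 1 + (j + 1) : ℕ) : ℝ) * b ^ (k + (j + 1)) * b ^ 2) +
      (-r) * b ^ 2 * ((-r) ^ j / j.factorial * (k.choose j) * b ^ (k + 1 + j)) := by
    intro j _
    have hc : (k.choose (j + 1) : ℝ) * (j + 1) = k.choose j * (k - j) := by
      rcases le_or_gt j k with h | h
      · have := Nat.choose_succ_right_eq k j
        rw [← Nat.cast_sub h]
        exact_mod_cast this
      · simp [Nat.choose_eq_zero_of_lt h, Nat.choose_eq_zero_of_lt (h.trans (Nat.lt_succ_self j))]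
    rw [Nat.choose_succ_succ, Nat.factorial_succ]
    have hj : (j.factorial : ℝ) ≠ 0 := by positivity
    have hj1 : (j : ℝ) + 1 ≠ 0 := by positivity
    push_cast
    field_simp
    linear_combination (-r) ^ (j + 1) * b ^ (k + j + 3) * (-1) * hc
  have hshift : ∑ j ∈ range (k + 1), (-r) ^ j / j.factorial * (k.choose j) *
      (((k + 1 + j : ℕ) : ℝ) * b ^ (k + j) * b ^ 2) =
      ∑ j ∈ range (k + 1), (-r) ^ (j + 1) / (j + 1).factorial * (k.choose (j + 1)) *
        (((k + 1 + (j + 1) : ℕ) : ℝ) * b ^ (k + (j + 1)) * b ^ 2) +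
      ((k + 1 : ℕ) : ℝ) * b ^ (k + 2) := by
    have h := sum_range_succ' (fun j => (-r) ^ j / j.factorial * (k.choose j) *
      (((k + 1 + j : ℕ) : ℝ) * b ^ (k + j) * b ^ 2)) (k + 1)
    rw [sum_range_succ] at h
    simp only [Nat.choose_succ_self] at h
    simp at h ⊢
    rw [h]
    ring
  have hsum' := sum_congr rfl hstep
  rw [← mul_sum, sum_add_distrib, ← mul_sum] at hsum'
  simp only [mul_neg, sum_neg_distrib]
  rw [hshift]
  push_cast at hsum' ⊢
  simp only [Nat.choose_zero_right, Nat.factorial_zero, pow_zero, Nat.cast_one, add_zero]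
  linear_combination (k.factorial : ℝ) * Real.exp (-r * b) * hsum'

lemma integral_phaseMoment (q : ℝ × ℝ) (k : ℕ) {a : ℝ} (ha : 0 < a) :
    ∫ p, phaseMoment q k a p =
      ((Real.pi * (momentPoly ((q.1 ^ 2 + q.2 ^ 2) / 4) k a⁻¹ *
        Real.exp (-((q.1 ^ 2 + q.2 ^ 2) / 4) * a⁻¹)) : ℝ) : ℂ) := by
  induction k generalizing a with
  | zero =>
    rw [integral_phaseMoment_zero q ha]
    simp [momentPoly, mul_assoc]
  | succ k ih =>
    have hl := hasDerivAt_integral_phaseMoment q k ha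
    have hr := ((hasDerivAt_momentPoly_mul_exp ((q.1 ^ 2 + q.2 ^ 2) / 4) k ha).const_mul
      Real.pi).ofReal_comp
    have heq := hl.unique (hr.congr_of_eventuallyEq
      ((eventually_gt_nhds ha).mono fun b hb => ih hb))
    rw [← neg_inj, heq]
    push_cast
    ring

end GaussianMoments

section LaguerreSums

lemma genLaguerre_zero_eq (n : ℕ) (x : ℝ) :
    genLaguerre n 0 x =
      ∑ k ∈ range (n + 1), (-1 : ℝ) ^ k / k.factorial * (n.choose k) * x ^ k := by
  refine sum_congr rfl fun k hk => ?_
  have hkn : k ≤ n := Nat.lt_succ_iff.mp (mem_range.mp hk)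
  have hprod : (k.factorial : ℝ) * ∏ j ∈ Icc (k + 1) n, ((0 : ℝ) + j) = n.factorial := by
    clear hk
    induction n, hkn using Nat.le_induction with
    | base => simp
    | succ m hm ih =>
      rw [prod_Icc_succ_top (by omega), ← mul_assoc, ih, Nat.factorial_succ]
      push_cast
      ring
  rw [Nat.cast_choose ℝ hkn, ← hprod]
  have : (k.factorial : ℝ) ≠ 0 := by positivity
  field_simp

lemma sum_choose_mul_choose_mul_pow (s j : ℕ) (y : ℝ) :
    ∑ k ∈ range (s + 1), (s.choose k : ℝ) * (k.choose j) * y ^ k =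
      s.choose j * y ^ j * (1 + y) ^ (s - j) := by
  rcases lt_or_ge s j with h | h
  · rw [Nat.choose_eq_zero_of_lt h]
    simp only [Nat.cast_zero, zero_mul]
    refine sum_eq_zero fun k hk => ?_
    rw [Nat.choose_eq_zero_of_lt (n := k) (k := j) (by have := mem_range.mp hk; omega)]
    simp
  · obtain ⟨m, rfl⟩ := Nat.exists_eq_add_of_le h
    rw [Nat.add_sub_cancel_left, add_comm 1 y, add_pow, mul_sum, add_assoc,
      sum_range_add, sum_eq_zero (s := range j), zero_add]
    · refine sum_congr rfl fun k hk => ?_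
      have hkm : k ≤ m := Nat.lt_succ_iff.mp (mem_range.mp hk)
      have h' := Nat.choose_mul (n := j + m) (k := j + k) (s := j) (by omega)
      rw [Nat.add_sub_cancel_left, Nat.add_sub_cancel_left] at h'
      have h'' : ((j + m).choose (j + k) : ℝ) * ((j + k).choose j) =
          (j + m).choose j * m.choose k := by exact_mod_cast h'
      rw [h'', pow_add]
      simp
      ring
    · intro k hk
      rw [Nat.choose_eq_zero_of_lt (mem_range.mp hk)]
      simp

lemma sum_laguerre_coeff_mul_momentPoly (s : ℕ) (x : ℝ) :
    ∑ k ∈ range (s + 1), (-1 : ℝ) ^ k / k.factorial * (s.choose k) * momentPoly (x / 4) k 2 =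
      2 * ((-1) ^ s * genLaguerre s 0 x) := by
  have hterm : ∀ k ∈ range (s + 1),
      (-1 : ℝ) ^ k / k.factorial * (s.choose k) * momentPoly (x / 4) k 2 =
      ∑ j ∈ range (s + 1), 2 * ((-(x / 4)) ^ j / j.factorial * 2 ^ j) *
        ((s.choose k : ℝ) * (k.choose j) * (-2) ^ k) := by
    intro k hk
    rw [momentPoly_eq_sum_range _ (Nat.lt_succ_iff.mp (mem_range.mp hk)), mul_sum, mul_sum]
    refine sum_congr rfl fun j _ => ?_
    have : (k.factorial : ℝ) ≠ 0 := by positivity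
    rw [neg_pow 2 k]
    field_simp
    ring
  rw [sum_congr rfl hterm, sum_comm, genLaguerre_zero_eq, mul_sum, mul_sum]
  refine sum_congr rfl fun j hj => ?_
  rw [← mul_sum, sum_choose_mul_choose_mul_pow]
  obtain ⟨m, rfl⟩ := Nat.exists_eq_add_of_le (Nat.lt_succ_iff.mp (mem_range.mp hj))
  rw [Nat.add_sub_cancel_left, show (1 + -2 : ℝ) = -1 by norm_num, pow_add,
    show -(x / 4) = (-1) * x * (1 / 2) * (1 / 2) by ring, show (-2 : ℝ) = (-1) * 2 by norm_num]
  simp only [mul_pow]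
  have h2 : ((1 : ℝ) / 2) ^ j * 2 ^ j = 1 := by rw [← mul_pow]; norm_num
  linear_combination 2 * ((-1 : ℝ) ^ j * x ^ j / j.factorial) * (j + m).choose j * (-1) ^ j *
    (-1) ^ m * ((1 / 2 : ℝ) ^ j * 2 ^ j + 1) * h2

end LaguerreSums

/-- the radial Laguerre–Gaussian functions are eigenfunctions, with
eigenvalue `(−1)^s`, of the two-dimensional symplectic Fourier transform. -/
theorem laguerre_gaussian_symplectic_fourier (s : ℕ) (q : ℝ × ℝ) :
    (1 / (2 * Real.pi) : ℂ) * (∫ p : ℝ × ℝ,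
        Complex.exp (Complex.I * ((q.1 * p.2 - q.2 * p.1 : ℝ) : ℂ)) *
          ((genLaguerre s 0 (p.1 ^ 2 + p.2 ^ 2) *
              Real.exp (-(p.1 ^ 2 + p.2 ^ 2) / 2) : ℝ) : ℂ))
      = (-1 : ℂ) ^ s *
          ((genLaguerre s 0 (q.1 ^ 2 + q.2 ^ 2) *
              Real.exp (-(q.1 ^ 2 + q.2 ^ 2) / 2) : ℝ) : ℂ) := by
  have hint : ∀ p : ℝ × ℝ,
      Complex.exp (Complex.I * ((q.1 * p.2 - q.2 * p.1 : ℝ) : ℂ)) *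
        ((genLaguerre s 0 (p.1 ^ 2 + p.2 ^ 2) *
          Real.exp (-(p.1 ^ 2 + p.2 ^ 2) / 2) : ℝ) : ℂ) =
      ∑ k ∈ range (s + 1), (((-1 : ℝ) ^ k / k.factorial * (s.choose k) : ℝ) : ℂ) *
        phaseMoment q k (1 / 2) p := by
    intro p
    rw [genLaguerre_zero_eq, show -(p.1 ^ 2 + p.2 ^ 2) / 2 = -(1 / 2) * (p.1 ^ 2 + p.2 ^ 2) by ring,
      sum_mul, Complex.ofReal_sum, mul_sum]
    refine sum_congr rfl fun k _ => ?_
    rw [phaseMoment, mul_assoc ((-1 : ℝ) ^ k / k.factorial * (s.choose k)), Complex.ofReal_mul]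
    ring
  simp_rw [hint]
  rw [integral_finsetSum _ fun k _ => (integrable_phaseMoment q k (by norm_num)).const_mul _]
  simp_rw [integral_const_mul, integral_phaseMoment q _ (show (0 : ℝ) < 1 / 2 by norm_num),
    ← Complex.ofReal_mul]
  rw [← Complex.ofReal_sum]
  have hsum := sum_laguerre_coeff_mul_momentPoly s (q.1 ^ 2 + q.2 ^ 2)
  have hreal : ∑ k ∈ range (s + 1), (-1 : ℝ) ^ k / k.factorial * (s.choose k) *
      (Real.pi * (momentPoly ((q.1 ^ 2 + q.2 ^ 2) / 4) k (1 / 2)⁻¹ *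
        Real.exp (-((q.1 ^ 2 + q.2 ^ 2) / 4) * (1 / 2)⁻¹))) =
      2 * Real.pi * ((-1) ^ s * (genLaguerre s 0 (q.1 ^ 2 + q.2 ^ 2) *
        Real.exp (-(q.1 ^ 2 + q.2 ^ 2) / 2))) := by
    rw [show ((1 : ℝ) / 2)⁻¹ = 2 by norm_num,
      show -((q.1 ^ 2 + q.2 ^ 2) / 4) * 2 = -(q.1 ^ 2 + q.2 ^ 2) / 2 by ring]
    calc _ = Real.pi * Real.exp (-(q.1 ^ 2 + q.2 ^ 2) / 2) * ∑ k ∈ range (s + 1),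
          (-1 : ℝ) ^ k / k.factorial * (s.choose k) *
            momentPoly ((q.1 ^ 2 + q.2 ^ 2) / 4) k 2 := by
          rw [mul_sum]
          exact sum_congr rfl fun k _ => by ring
      _ = _ := by rw [hsum]; ring
  rw [hreal]
  have hpi : (Real.pi : ℂ) ≠ 0 := by exact_mod_cast Real.pi_ne_zero
  push_cast
  field_simp
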